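/- Let X be a real Banach space, let T : [0,∞) → B(X) be a strongly continuous semigroup with generator A, and let ω ∈ ℝ, M ≥ 0 satisfy ‖T(t)‖ ≤ M e^{ωt} for all t ≥ 0. Let a, b ∈ ℝ with a > ω, let Q be the (bounded, everywhere defined) inverse of the bijective operator Δ := A² − 2a A + (a² + b²)·Id : D(A²) → X, and let g(t) := t e^{−a t} sinc(b t) for t ≥ 0. Then for every integer n ≥ 1 and every x ∈ X, the n-fold convolution g^{⋆n} satisfies ∫_0^∞ ‖T(t)‖ |g^{⋆n}(t)| dt < ∞ and Q^n x = ∫_0^∞ g^{⋆n}(t) · T(t)x dt (Bochner integral). -/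

import Mathlib

open MeasureTheory Filter Set Quaternion

noncomputable section

/-- The unnormalized sinc function. -/
def sinc (r : ℝ) : ℝ := if r = 0 then 1 else Real.sin r / r

/-- `T : [0,∞) → B(X)` is a strongly continuous semigroup. -/
def IsSCSemigroup {X : Type*} [NormedAddCommGroup X] [NormedSpace ℝ X]
    (T : ℝ → X →L[ℝ] X) : Prop :=
  T 0 = 1 ∧ (∀ s t : ℝ, 0 ≤ s → 0 ≤ t → T (t + s) = (T t).comp (T s)) ∧
    ∀ x : X, ContinuousOn (fun t => T t x) (Set.Ici 0)

/-- The domain of the generator of `T`. -/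
def genDomain {X : Type*} [NormedAddCommGroup X] [NormedSpace ℝ X]
    (T : ℝ → X →L[ℝ] X) : Set X :=
  {x | ∃ y : X, Tendsto (fun h : ℝ => (1 / h) • (T h x - x)) (nhdsWithin 0 (Set.Ioi 0)) (nhds y)}

/-- `A` is the generator of `T` (its values outside `genDomain T` are irrelevant). -/
def IsGenerator {X : Type*} [NormedAddCommGroup X] [NormedSpace ℝ X]
    (T : ℝ → X →L[ℝ] X) (A : X → X) : Prop :=
  ∀ x ∈ genDomain T,
    Tendsto (fun h : ℝ => (1 / h) • (T h x - x)) (nhdsWithin 0 (Set.Ioi 0)) (nhds (A x))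

/-- `iterDomain T A k` is `D(A^k)`. -/
def iterDomain {X : Type*} [NormedAddCommGroup X] [NormedSpace ℝ X]
    (T : ℝ → X →L[ℝ] X) (A : X → X) : ℕ → Set X
  | 0 => Set.univ
  | k + 1 => {x | x ∈ iterDomain T A k ∧ A^[k] x ∈ genDomain T}

/-- Convolution of two functions on `[0,∞)`. -/
def conv (f g : ℝ → ℝ) (t : ℝ) : ℝ := ∫ s in (0 : ℝ)..t, f (t - s) * g s

/-- `convPow g n` is the `(n+1)`-fold convolution power `g ⋆ ⋯ ⋆ g` (`n+1` factors). -/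
def convPow (g : ℝ → ℝ) : ℕ → ℝ → ℝ
  | 0 => g
  | n + 1 => conv g (convPow g n)

section Semigroup

variable {X : Type*} [NormedAddCommGroup X] [NormedSpace ℝ X]

theorem IsSCSemigroup.measurableNorm_comp_max {T : ℝ → X →L[ℝ] X} (hT : IsSCSemigroup T) :
    Measurable (fun t => ‖T (max t 0)‖) := by
  have hcont : ∀ x : X, Continuous (fun t => T (max t 0) x) := fun x =>
    (hT.2.2 x).comp_continuous (by fun_prop) (fun t => le_max_right t 0)
  refine measurable_of_Ioi fun c => ?_
  rcases lt_or_ge c 0 with hc | hc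
  · convert MeasurableSet.univ
    ext t
    simpa using hc.trans_le (norm_nonneg _)
  · have : (fun t => ‖T (max t 0)‖) ⁻¹' Ioi c = ⋃ x : X, {t | c * ‖x‖ < ‖T (max t 0) x‖} := by
      ext t
      simp only [mem_preimage, mem_Ioi, mem_iUnion, mem_ofPred_eq]
      constructor
      · intro h
        by_contra! h'
        exact absurd ((T (max t 0)).opNorm_le_bound hc h') (not_le.2 h)
      · rintro ⟨x, hx⟩
        by_contra! h'
        exact absurd (((T (max t 0)).le_opNorm x).trans
          (mul_le_mul_of_nonneg_right h' (norm_nonneg x))) (not_le.2 hx)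
    rw [this]
    exact (isOpen_iUnion fun x => isOpen_lt continuous_const (hcont x).norm).measurableSet

theorem IsSCSemigroup.aestronglyMeasurable_norm {T : ℝ → X →L[ℝ] X} (hT : IsSCSemigroup T) :
    AEStronglyMeasurable (fun t => ‖T t‖) (volume.restrict (Ioi 0)) := by
  refine hT.measurableNorm_comp_max.aestronglyMeasurable.congr ?_
  filter_upwards [ae_restrict_mem measurableSet_Ioi] with t ht
  rw [max_eq_left (le_of_lt ht)]

theorem IsSCSemigroup.hasDerivWithinAt {T : ℝ → X →L[ℝ] X} (hT : IsSCSemigroup T)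
    {A : X → X} (hA : IsGenerator T A) {y : X} (hy : y ∈ genDomain T) {t : ℝ} (ht : 0 ≤ t) :
    HasDerivWithinAt (fun u => T u y) (T t (A y)) (Ioi t) t := by
  rw [hasDerivWithinAt_iff_tendsto_slope' self_notMem_Ioi]
  have hsub : Tendsto (fun u => u - t) (nhdsWithin t (Ioi t)) (nhdsWithin 0 (Ioi 0)) := by
    refine tendsto_nhdsWithin_iff.2 ⟨?_, ?_⟩
    · have : Continuous (fun u : ℝ => u - t) := by fun_prop
      simpa using this.continuousWithinAt (s := Ioi t) (x := t) |>.tendsto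
    · filter_upwards [self_mem_nhdsWithin] with u hu
      simpa using hu
  refine (((T t).continuous.tendsto _).comp ((hA y hy).comp hsub)).congr' ?_
  filter_upwards [self_mem_nhdsWithin] with u hu
  have hsg : T u = (T t).comp (T (u - t)) := by
    rw [← hT.2.1 (u - t) t (sub_nonneg.2 (le_of_lt hu)) ht, add_sub_cancel]
  simp [slope_def_module, hsg]

variable {T : ℝ → X →L[ℝ] X} {ω M : ℝ}

theorem norm_smul_semigroup_le (hbound : ∀ t : ℝ, 0 ≤ t → ‖T t‖ ≤ M * Real.exp (ω * t))
    (r : ℝ) (x : X) {t : ℝ} (ht : 0 ≤ t) :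
    ‖r • T t x‖ ≤ M * ‖x‖ * (|r| * Real.exp (ω * t)) := by
  rw [norm_smul, Real.norm_eq_abs]
  calc |r| * ‖T t x‖ ≤ |r| * (M * Real.exp (ω * t) * ‖x‖) := by
        gcongr
        exact (T t).le_of_opNorm_le (hbound t ht) x
    _ = _ := by ring

theorem tendsto_smul_semigroup (hbound : ∀ t : ℝ, 0 ≤ t → ‖T t‖ ≤ M * Real.exp (ω * t))
    {f : ℝ → ℝ} (hf : Tendsto (fun t => f t * Real.exp (ω * t)) atTop (nhds 0)) (x : X) :
    Tendsto (fun t => f t • T t x) atTop (nhds 0) := by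
  have h : Tendsto (fun t => M * ‖x‖ * (|f t| * Real.exp (ω * t))) atTop (nhds 0) := by
    simpa [abs_mul] using hf.abs.const_mul (M * ‖x‖)
  refine squeeze_zero_norm' ?_ h
  filter_upwards [eventually_ge_atTop 0] with t ht
  exact norm_smul_semigroup_le hbound _ x ht

theorem IsSCSemigroup.integrableOn_smul (hT : IsSCSemigroup T)
    (hbound : ∀ t : ℝ, 0 ≤ t → ‖T t‖ ≤ M * Real.exp (ω * t)) {f : ℝ → ℝ} (hf : Continuous f)
    (hfi : IntegrableOn (fun t => |f t| * Real.exp (ω * t)) (Ioi 0)) (x : X) :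
    IntegrableOn (fun t => f t • T t x) (Ioi 0) := by
  refine (hfi.const_mul (M * ‖x‖)).mono' ?_ ?_
  · exact (hf.continuousOn.smul ((hT.2.2 x).mono Ioi_subset_Ici_self)).aestronglyMeasurable
      measurableSet_Ioi
  · filter_upwards [ae_restrict_mem measurableSet_Ioi] with t ht
    exact norm_smul_semigroup_le hbound _ x (le_of_lt ht)

theorem IsSCSemigroup.integrableOn_norm_mul (hT : IsSCSemigroup T)
    (hbound : ∀ t : ℝ, 0 ≤ t → ‖T t‖ ≤ M * Real.exp (ω * t)) {f : ℝ → ℝ} (hf : Continuous f)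
    (hfi : IntegrableOn (fun t => |f t| * Real.exp (ω * t)) (Ioi 0)) :
    IntegrableOn (fun t => ‖T t‖ * |f t|) (Ioi 0) := by
  refine (hfi.const_mul M).mono' (hT.aestronglyMeasurable_norm.mul
    hf.abs.aestronglyMeasurable) ?_
  filter_upwards [ae_restrict_mem measurableSet_Ioi] with t ht
  rw [Real.norm_of_nonneg (by positivity)]
  calc ‖T t‖ * |f t| ≤ M * Real.exp (ω * t) * |f t| := by
        gcongr
        exact hbound t (le_of_lt ht)
    _ = _ := by ring

/-- Integration by parts against a solution of a constant-coefficient second-order equation with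
`g 0 = 0` and `g' 0 = 1`. -/
theorem IsSCSemigroup.integral_smul_quadratic [CompleteSpace X] (hT : IsSCSemigroup T)
    {A : X → X} (hA : IsGenerator T A)
    (hbound : ∀ t : ℝ, 0 ≤ t → ‖T t‖ ≤ M * Real.exp (ω * t)) {a c : ℝ} {g g' : ℝ → ℝ}
    (hg : ∀ t, HasDerivAt g (g' t) t) (hg' : ∀ t, HasDerivAt g' (-(2 * a * g' t + c * g t)) t)
    (hg0 : g 0 = 0) (hg'0 : g' 0 = 1)
    (hgi : IntegrableOn (fun t => |g t| * Real.exp (ω * t)) (Ioi 0))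
    (hglim : Tendsto (fun t => g t * Real.exp (ω * t)) atTop (nhds 0))
    (hg'lim : Tendsto (fun t => g' t * Real.exp (ω * t)) atTop (nhds 0))
    {y : X} (hy : y ∈ genDomain T) (hAy : A y ∈ genDomain T) :
    ∫ t in Ioi (0 : ℝ), g t • T t (A (A y) - (2 * a) • A y + c • y) = y := by
  set z := A (A y) - (2 * a) • A y + c • y with hz
  have hgc : Continuous g := continuous_iff_continuousAt.2 fun t => (hg t).continuousAt
  have hgc' : Continuous g' := continuous_iff_continuousAt.2 fun t => (hg' t).continuousAt
  set F : ℝ → X := fun t => g t • T t (A y) - g' t • T t y - (2 * a) • g t • T t y with hF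
  have hFc : ContinuousOn F (Ici 0) :=
    ((hgc.continuousOn.smul (hT.2.2 _)).sub (hgc'.continuousOn.smul (hT.2.2 _))).sub
      ((hgc.continuousOn.smul (hT.2.2 _)).const_smul _)
  have hFd : ∀ t, 0 ≤ t → HasDerivWithinAt F (g t • T t z) (Ioi t) t := by
    intro t ht
    have d1 := hT.hasDerivWithinAt hA hy ht
    have d2 := hT.hasDerivWithinAt hA hAy ht
    have e1 := (hg t).hasDerivWithinAt (s := Ioi t)
    have e2 := (hg' t).hasDerivWithinAt (s := Ioi t)
    refine (((e1.smul d2).sub (e2.smul d1)).sub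
      ((e1.smul d1).const_smul (2 * a))).congr_deriv ?_
    rw [hz]
    simp only [map_add, map_sub, map_smul]
    module
  have hint := hT.integrableOn_smul hbound hgc hgi z
  have hFTC : ∀ t, 0 ≤ t → ∫ s in (0 : ℝ)..t, g s • T s z = F t - F 0 := by
    intro t ht
    refine intervalIntegral.integral_eq_sub_of_hasDeriv_right_of_le ht
      (hFc.mono Icc_subset_Ici_self) (fun s hs => hFd s hs.1.le) ?_
    rw [intervalIntegrable_iff_integrableOn_Ioc_of_le ht]
    exact hint.mono_set Ioc_subset_Ioi_self
  have hF0 : F 0 = -y := by simp [hF, hg0, hg'0, hT.1]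
  have hFlim : Tendsto F atTop (nhds 0) := by
    simpa using ((tendsto_smul_semigroup hbound hglim (A y)).sub
      (tendsto_smul_semigroup hbound hg'lim y)).sub
      ((tendsto_smul_semigroup hbound hglim y).const_smul (2 * a))
  have h1 := intervalIntegral_tendsto_integral_Ioi 0 hint tendsto_id
  have h2 : Tendsto (fun t => F t - F 0) atTop (nhds y) := by
    simpa [hF0] using hFlim.sub_const (F 0)
  refine tendsto_nhds_unique h1 (h2.congr' ?_)
  filter_upwards [eventually_ge_atTop 0] with t ht
  exact (hFTC t ht).symm

/-- The functional calculus `f ↦ ∫ f(t) T(t) dt` turns convolutions into compositions. -/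
theorem IsSCSemigroup.integral_conv_smul [CompleteSpace X] (hT : IsSCSemigroup T)
    (hbound : ∀ t : ℝ, 0 ≤ t → ‖T t‖ ≤ M * Real.exp (ω * t)) {f g : ℝ → ℝ}
    (hf : Continuous f) (hg : Continuous g)
    (hfi : IntegrableOn (fun t => |f t| * Real.exp (ω * t)) (Ioi 0))
    (hgi : IntegrableOn (fun t => |g t| * Real.exp (ω * t)) (Ioi 0)) (x : X) :
    ∫ t in Ioi (0 : ℝ), f t • T t (∫ s in Ioi (0 : ℝ), g s • T s x) =
      ∫ u in Ioi (0 : ℝ), conv f g u • T u x := by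
  set H : ℝ × ℝ → X := fun p => (f p.1 * g p.2) • T (p.1 + p.2) x with hH
  set G : ℝ × ℝ → X := (Ioi (0 : ℝ) ×ˢ Ioi (0 : ℝ)).indicator H with hG
  have hmeas : MeasurableSet (Ioi (0 : ℝ) ×ˢ Ioi (0 : ℝ)) :=
    measurableSet_Ioi.prod measurableSet_Ioi
  have hHc : ContinuousOn H (Ioi (0 : ℝ) ×ˢ Ioi (0 : ℝ)) := by
    refine ContinuousOn.smul (by fun_prop) ((hT.2.2 x).comp (by fun_prop) ?_)
    rintro ⟨t, s⟩ ⟨ht, hs⟩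
    exact (add_pos (mem_Ioi.1 ht) (mem_Ioi.1 hs)).le
  have hGi : Integrable G (volume.prod volume) := by
    rw [hG, integrable_indicator_iff hmeas]
    have hb := (hfi.mul_prod hgi).const_mul (M * ‖x‖)
    rw [Measure.prod_restrict] at hb
    refine hb.mono' (hHc.aestronglyMeasurable hmeas) ?_
    filter_upwards [ae_restrict_mem hmeas] with p hp
    have hp' : 0 ≤ p.1 + p.2 := (add_pos hp.1 hp.2).le
    refine (norm_smul_semigroup_le hbound _ x hp').trans_eq ?_
    rw [abs_mul, mul_add, Real.exp_add]
    ring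
  have hshear : MeasurePreserving (fun p : ℝ × ℝ => (p.1 - p.2, p.2))
      (volume.prod volume) (volume.prod volume) := measurePreserving_sub_prod _ _
  have hGs : Integrable (fun p : ℝ × ℝ => G (p.1 - p.2, p.2)) (volume.prod volume) :=
    hshear.integrable_comp_of_integrable hGi
  have hleft : ∫ t in Ioi (0 : ℝ), f t • T t (∫ s in Ioi (0 : ℝ), g s • T s x) =
      ∫ t, ∫ s, G (t, s) := by
    rw [← integral_indicator measurableSet_Ioi]
    refine integral_congr_ae (Eventually.of_forall fun t => ?_)
    by_cases ht : t ∈ Ioi (0 : ℝ)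
    · simp only [indicator_of_mem ht]
      rw [← (T t).integral_comp_comm (hT.integrableOn_smul hbound hg hgi x), ← integral_smul,
        ← integral_indicator measurableSet_Ioi]
      refine integral_congr_ae (Eventually.of_forall fun s => ?_)
      by_cases hs : s ∈ Ioi (0 : ℝ)
      · have : (t, s) ∈ Ioi (0 : ℝ) ×ˢ Ioi (0 : ℝ) := ⟨ht, hs⟩
        simp [hG, hH, indicator_of_mem hs, indicator_of_mem this, smul_smul,
          hT.2.1 s t (le_of_lt hs) (le_of_lt ht)]
      · have : (t, s) ∉ Ioi (0 : ℝ) ×ˢ Ioi (0 : ℝ) := fun h => hs h.2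
        simp only [hG, indicator_of_notMem hs, indicator_of_notMem this]
    · have : ∀ s, (t, s) ∉ Ioi (0 : ℝ) ×ˢ Ioi (0 : ℝ) := fun s h => ht h.1
      simp [hG, indicator_of_notMem ht, indicator_of_notMem (this _)]
  have hright : ∫ u, ∫ s, G (u - s, s) = ∫ u in Ioi (0 : ℝ), conv f g u • T u x := by
    rw [← integral_indicator measurableSet_Ioi]
    refine integral_congr_ae (Eventually.of_forall fun u => ?_)
    have hiff : ∀ s, (u - s, s) ∈ Ioi (0 : ℝ) ×ˢ Ioi (0 : ℝ) ↔ s ∈ Ioo 0 u := fun s => by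
      simp [and_comm]
    have hGu : ∀ s, G (u - s, s) = (Ioo 0 u).indicator (fun s => (f (u - s) * g s) • T u x) s := by
      intro s
      by_cases hs : s ∈ Ioo 0 u
      · rw [indicator_of_mem hs, hG, indicator_of_mem ((hiff s).2 hs)]
        simp [hH]
      · rw [indicator_of_notMem hs, hG, indicator_of_notMem (mt (hiff s).1 hs)]
    simp only [hGu]
    rw [integral_indicator measurableSet_Ioo]
    by_cases hu : u ∈ Ioi (0 : ℝ)
    · rw [indicator_of_mem hu, integral_smul_const, conv,
        intervalIntegral.integral_of_le (le_of_lt hu), integral_Ioc_eq_integral_Ioo]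
    · rw [indicator_of_notMem hu, Ioo_eq_empty hu]
      simp
  rw [hleft, ← hright, integral_integral_swap (f := fun t s => G (t, s)) hGi,
    integral_integral_swap (f := fun u s => G (u - s, s)) hGs]
  refine integral_congr_ae (Eventually.of_forall fun s => ?_)
  exact (integral_sub_right_eq_self (fun t => G (t, s)) s).symm

end Semigroup

section Kernel

theorem Continuous.conv {f g : ℝ → ℝ} (hf : Continuous f) (hg : Continuous g) :
    Continuous (conv f g) := by
  refine intervalIntegral.continuous_parametric_intervalIntegral_of_continuous
    (f := fun t s => f (t - s) * g s) ?_ continuous_id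
  fun_prop

theorem Continuous.convPow {g : ℝ → ℝ} (hg : Continuous g) (n : ℕ) :
    Continuous (convPow g n) := by
  induction n with
  | zero => exact hg
  | succ n ih => exact hg.conv ih

theorem abs_conv_le {f g : ℝ → ℝ} {a : ℝ} {k : ℕ}
    (hf : ∀ t, 0 ≤ t → |f t| ≤ t * Real.exp (-(a * t)))
    (hg : ∀ t, 0 ≤ t → |g t| ≤ t ^ k * Real.exp (-(a * t))) {t : ℝ} (ht : 0 ≤ t) :
    |conv f g t| ≤ t ^ (k + 2) * Real.exp (-(a * t)) := by
  have h := intervalIntegral.norm_integral_le_of_norm_le_const (a := 0) (b := t)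
    (f := fun s => f (t - s) * g s) (C := t ^ (k + 1) * Real.exp (-(a * t))) ?_
  · rw [Real.norm_eq_abs, sub_zero, abs_of_nonneg ht] at h
    exact h.trans_eq (by ring)
  · intro s hs
    rw [uIoc_of_le ht] at hs
    have hts : 0 ≤ t - s := sub_nonneg.2 hs.2
    rw [Real.norm_eq_abs, abs_mul]
    calc |f (t - s)| * |g s|
        ≤ ((t - s) * Real.exp (-(a * (t - s)))) * (s ^ k * Real.exp (-(a * s))) := by
          gcongr
          exacts [hf _ hts, hg _ hs.1.le]
      _ = ((t - s) * s ^ k) * Real.exp (-(a * t)) := by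
          rw [show -(a * t) = -(a * (t - s)) + -(a * s) by ring, Real.exp_add]
          ring
      _ ≤ (t * t ^ k) * Real.exp (-(a * t)) := by
          have h0 := hs.1.le
          gcongr
          exacts [by linarith, hs.2]
      _ = _ := by ring

theorem abs_convPow_le {g : ℝ → ℝ} {a : ℝ}
    (hg : ∀ t, 0 ≤ t → |g t| ≤ t * Real.exp (-(a * t))) (n : ℕ) :
    ∀ t, 0 ≤ t → |convPow g n t| ≤ t ^ (2 * n + 1) * Real.exp (-(a * t)) := by
  induction n with
  | zero => simpa [convPow] using hg
  | succ n ih => exact fun t ht => abs_conv_le hg ih ht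

theorem tendsto_pow_mul_exp_neg_mul {δ : ℝ} (hδ : 0 < δ) (k : ℕ) :
    Tendsto (fun t => t ^ k * Real.exp (-(δ * t))) atTop (nhds 0) := by
  have h := ((Real.tendsto_pow_mul_exp_neg_atTop_nhds_zero k).comp
    (tendsto_id.const_mul_atTop hδ)).const_mul ((δ ^ k)⁻¹)
  rw [mul_zero] at h
  refine h.congr fun t => ?_
  simp only [Function.comp, id, mul_pow]
  field_simp

theorem integrableOn_of_abs_le_pow_mul_exp {f : ℝ → ℝ} (hf : Continuous f) {a ω : ℝ} (ha : ω < a)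
    {k : ℕ} (hle : ∀ t, 0 ≤ t → |f t| ≤ t ^ k * Real.exp (-(a * t))) :
    IntegrableOn (fun t => |f t| * Real.exp (ω * t)) (Ioi 0) := by
  have h := integrableOn_rpow_mul_exp_neg_mul_rpow (s := k) (p := 1) (b := a - ω)
    (by linarith [(Nat.cast_nonneg k : (0 : ℝ) ≤ k)]) one_pos (sub_pos.2 ha)
  refine h.mono' (by fun_prop) ?_
  filter_upwards [ae_restrict_mem measurableSet_Ioi] with t ht
  rw [Real.norm_of_nonneg (by positivity), Real.rpow_natCast, Real.rpow_one]
  calc |f t| * Real.exp (ω * t) ≤ t ^ k * Real.exp (-(a * t)) * Real.exp (ω * t) := by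
        gcongr
        exact hle t (le_of_lt ht)
    _ = _ := by
        rw [mul_assoc, ← Real.exp_add]
        ring_nf

theorem abs_sinc_le_one (r : ℝ) : |sinc r| ≤ 1 := by
  simpa [sinc, Real.sinc] using Real.abs_sinc_le_one r

theorem hasDerivAt_mul_sinc (b t : ℝ) :
    HasDerivAt (fun t => t * sinc (b * t)) (Real.cos (b * t)) t := by
  rcases eq_or_ne b 0 with rfl | hb
  · simpa [sinc] using hasDerivAt_id' t
  · have heq : (fun t => t * sinc (b * t)) = fun t => Real.sin (b * t) / b := by
      ext t
      rcases eq_or_ne t 0 with rfl | ht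
      · simp
      · simp only [sinc, mul_eq_zero, hb, ht, or_self, if_false]
        field_simp
    rw [heq]
    have := ((hasDerivAt_id t).const_mul b).sin.div_const b
    simpa [hb] using this

theorem sq_mul_mul_sinc (b t : ℝ) : b ^ 2 * (t * sinc (b * t)) = b * Real.sin (b * t) := by
  rcases eq_or_ne (b * t) 0 with h | h
  · simp only [h, Real.sin_zero, mul_zero]
    linear_combination b * sinc 0 * h
  · simp only [sinc, h, if_false]
    have hb := left_ne_zero_of_mul h
    have ht := right_ne_zero_of_mul h
    field_simp

end Kernel

theorem stmt_8 {X : Type*} [NormedAddCommGroup X] [NormedSpace ℝ X] [CompleteSpace X]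
    (T : ℝ → X →L[ℝ] X) (hT : IsSCSemigroup T) (A : X → X) (hA : IsGenerator T A)
    (ω M : ℝ) (hM : 0 ≤ M) (hbound : ∀ t : ℝ, 0 ≤ t → ‖T t‖ ≤ M * Real.exp (ω * t))
    (a b : ℝ) (ha : ω < a) (Q : X →L[ℝ] X)
    (hQleft : ∀ x ∈ iterDomain T A 2,
      Q (A^[2] x - (2 * a) • A x + (a ^ 2 + b ^ 2) • x) = x)
    (hQright : ∀ x : X, Q x ∈ iterDomain T A 2 ∧
      A^[2] (Q x) - (2 * a) • A (Q x) + (a ^ 2 + b ^ 2) • Q x = x)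
    (g : ℝ → ℝ) (hgdef : ∀ t : ℝ, g t = t * Real.exp (-(a * t)) * sinc (b * t)) :
    ∀ n : ℕ,
      IntegrableOn (fun t => ‖T t‖ * |convPow g n t|) (Set.Ioi 0) ∧
      ∀ x : X, (Q ^ (n + 1)) x = ∫ t in Set.Ioi (0 : ℝ), convPow g n t • T t x := by
  set s : ℝ → ℝ := fun t => t * sinc (b * t) with hs
  set e : ℝ → ℝ := fun t => Real.exp (-(a * t)) with he
  set g' : ℝ → ℝ := fun t => e t * (Real.cos (b * t) - a * s t) with hg'
  have hge : g = fun t => e t * s t := by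
    ext t
    rw [hgdef]
    simp only [he, hs]
    ring
  have hde : ∀ t, HasDerivAt e (-a * e t) t := fun t => by
    simpa [he, mul_comm] using ((hasDerivAt_id t).const_mul a).neg.exp
  have hds : ∀ t, HasDerivAt s (Real.cos (b * t)) t := hasDerivAt_mul_sinc b
  have hdg : ∀ t, HasDerivAt g (g' t) t := fun t => by
    rw [hge]
    refine ((hde t).mul (hds t)).congr_deriv ?_
    simp only [hg']
    ring
  have hdg' : ∀ t, HasDerivAt g' (-(2 * a * g' t + (a ^ 2 + b ^ 2) * g t)) t := fun t => by
    have hcos : HasDerivAt (fun t => Real.cos (b * t)) (-(b * Real.sin (b * t))) t := by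
      simpa [mul_comm] using ((hasDerivAt_id t).const_mul b).cos
    refine ((hde t).mul (hcos.sub ((hds t).const_mul a))).congr_deriv ?_
    have hsq : b ^ 2 * s t = b * Real.sin (b * t) := sq_mul_mul_sinc b t
    rw [← hsq, hge]
    simp only [hg', Pi.sub_apply]
    ring
  have hgc : Continuous g := continuous_iff_continuousAt.2 fun t => (hdg t).continuousAt
  have hsle : ∀ t, 0 ≤ t → |s t| ≤ t := fun t ht => by
    simp only [hs, abs_mul, abs_of_nonneg ht]
    exact mul_le_of_le_one_right ht (abs_sinc_le_one _)
  have hgle : ∀ t, 0 ≤ t → |g t| ≤ t * Real.exp (-(a * t)) := fun t ht => by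
    rw [hge]
    simp only [he, abs_mul, Real.abs_exp]
    rw [mul_comm]
    gcongr
    exact hsle t ht
  have hexp : ∀ t, e t * Real.exp (ω * t) = Real.exp (-((a - ω) * t)) := fun t => by
    simp only [he, ← Real.exp_add]
    ring_nf
  have hlim0 := tendsto_pow_mul_exp_neg_mul (sub_pos.2 ha) 0
  have hlim1 := tendsto_pow_mul_exp_neg_mul (sub_pos.2 ha) 1
  simp only [pow_zero, one_mul, pow_one] at hlim0 hlim1
  have hglim : Tendsto (fun t => g t * Real.exp (ω * t)) atTop (nhds 0) := by
    refine squeeze_zero_norm' ?_ hlim1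
    filter_upwards [eventually_ge_atTop 0] with t ht
    rw [Real.norm_eq_abs, abs_mul, Real.abs_exp, ← hexp, ← mul_assoc]
    gcongr
    exact hgle t ht
  have hg'lim : Tendsto (fun t => g' t * Real.exp (ω * t)) atTop (nhds 0) := by
    have hcos : Tendsto (fun t => Real.cos (b * t) * Real.exp (-((a - ω) * t))) atTop
        (nhds 0) := by
      refine squeeze_zero_norm (fun t => ?_) hlim0
      rw [Real.norm_eq_abs, abs_mul, Real.abs_exp]
      exact mul_le_of_le_one_left (Real.exp_pos _).le (Real.abs_cos_le_one _)
    have h := hcos.sub (hglim.const_mul a)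
    simp only [mul_zero, sub_zero] at h
    refine h.congr fun t => ?_
    rw [← hexp, hge]
    simp only [hg']
    ring
  have hcont : ∀ n, Continuous (convPow g n) := hgc.convPow
  have hint : ∀ n, IntegrableOn (fun t => |convPow g n t| * Real.exp (ω * t)) (Ioi 0) := fun n =>
    integrableOn_of_abs_le_pow_mul_exp (hcont n) ha (abs_convPow_le hgle n)
  have hQ : ∀ x, Q x = ∫ t in Ioi (0 : ℝ), g t • T t x := fun x => by
    obtain ⟨⟨⟨-, hy⟩, hAy⟩, hx⟩ := hQright x
    have h := hT.integral_smul_quadratic hA hbound hdg hdg' (by simp [hgdef])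
      (by simp [hg', he, hs]) (hint 0) hglim hg'lim hy hAy
    exact h.symm.trans (congrArg (fun z => ∫ t in Ioi (0 : ℝ), g t • T t z) hx)
  intro n
  refine ⟨hT.integrableOn_norm_mul hbound (hcont n) (hint n), fun x => ?_⟩
  induction n with
  | zero => simpa [convPow] using hQ x
  | succ n ih =>
    rw [pow_succ', mul_apply_eq_comp, ih, hQ]
    exact hT.integral_conv_smul hbound hgc (hcont n) (hint 0) (hint n) x
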